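/- Let a₀₀, a₀₁, a₁₀, a₁₁, b₀₀, b₀₁, b₁₀, b₁₁ > 0 be real numbers satisfying a₀₀a₁₁ = a₀₁a₁₀ (i.e. a₋ = 0), let p, m, n ≥ 1 be integers, and set L = 2p, M = 2m, N = 2n. Define a₊ = a₀₀a₁₁ + a₀₁a₁₀, b₊ = b₀₁b₁₁ + b₀₀b₁₀, b₋ = b₀₁b₁₁ − b₀₀b₁₀, c₀ = (a₀₀b₁₁+a₁₀b₀₀)(a₁₁b₀₁+a₀₁b₁₀), c₁ = (a₀₁b₁₁+a₁₁b₀₀)(a₁₀b₀₁+a₀₀b₁₀), d = a₀₀b₁₁+a₁₀b₀₀. Let A₀(z) be the 2×2 matrix with rows (b₀₀, a₀₀) and (a₀₁z, b₀₁), A₁(z) the 2×2 matrix with rows (b₁₀, a₁₀) and (a₁₁z, b₁₁), A(z) = A₀(z)A₁(z), and W(z) = z^{−(m+n)}·A(z)^p for z ≠ 0. Define φ(ζ) = (ζ²−b₋²)/(2(c₀+c₁)), φ'(ζ) = ζ/(c₀+c₁), λ̂(ζ) = (a₊·φ(ζ)+b₊+ζ)/2, the column vector u(ζ) = (1, (ζ+b₋)/(2d))ᵀ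 and the row vector v(ζ) = ((ζ−b₋)/(2ζ), d/ζ). Fix a real ρ > |b₋| with ρ > 0, and define the scalar weight 𝒲(ω) = λ̂(ω)^p·φ(ω)^{−(m+n)}/(c₀+c₁). Assume 𝓡 : ℂ×ℂ → M₂(ℂ) is a left reproducing kernel of order n for W on the unit circle, and assume 𝒦 : ℂ×ℂ → ℂ is a scalar left reproducing kernel of order 2n for 𝒲 on the circle of radius ρ which is moreover unique. Then for all ε₁, ε₂ ∈ {0,1} and all integers x₁, x₂, y₁, y₂ with 1 ≤ 2x₁+ε₁ ≤ L−1 and 1 ≤ 2x₂−ε₂ ≤ L−1, writing χ = 1 if 2x₁+ε₁ > 2x₂−ε₂ and χ = 0 otherwise, the following identity of 2×2 matrices holds: −(χ/(2πi))·∮_{|z|=1} A₁(z)^{ε₂}·A(z)^{x₁−x₂}·A₀(z)^{ε₁}·z^{y₂−y₁−1} dz + (1/(2πi))·∮_{|w|=1}∮_{|z|=1} w^{y₂−m−n}·z^{−y₁−1}·A₁(w)^{ε₂}·A(w)^{p−x₂}·𝓡(w,z)·A(z)^{x₁}·A₀(z)^{ε₁} dz dw = −(χ/(2πi))·∮_{|ζ|=ρ}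 λ̂(ζ)^{x₁−x₂}·φ(ζ)^{y₂−y₁−1}·φ'(ζ)·A₁(φ(ζ))^{ε₂}·u(ζ)·v(ζ)·A₀(φ(ζ))^{ε₁} dζ + (1/(2πi))·∮_{|ω|=ρ}∮_{|ζ|=ρ} (𝒦(ω,ζ)/ω)·λ̂(ω)^{p−x₂}·φ(ω)^{y₂−m−n}·λ̂(ζ)^{x₁}·φ(ζ)^{−y₁−1}·φ'(ω)·φ'(ζ)·A₁(φ(ω))^{ε₂}·u(ω)·v(ζ)·A₀(φ(ζ))^{ε₁} dζ dω, where u(ω)·v(ζ) denotes the 2×2 outer-product matrix. -/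

import Mathlib

/-- An `m × n` matrix polynomial of degree at most `d`:
`P z = ∑_{ℓ=0}^{d} z ^ ℓ • C ℓ` for some constant matrices `C ℓ`. -/
def IsMatPoly (m n d : ℕ) (P : ℂ → Matrix (Fin m) (Fin n) ℂ) : Prop :=
  ∃ C : ℕ → Matrix (Fin m) (Fin n) ℂ,
    ∀ z : ℂ, P z = ∑ ℓ ∈ Finset.range (d + 1), z ^ ℓ • C ℓ

/-- A scalar polynomial of degree at most `d`. -/
def IsPolyDeg (d : ℕ) (f : ℂ → ℂ) : Prop :=
  ∃ c : ℕ → ℂ, ∀ z : ℂ, f z = ∑ ℓ ∈ Finset.range (d + 1), c ℓ * z ^ ℓ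

/-- Entrywise counterclockwise integral of a matrix-valued function over the circle
`|z| = ρ` centered at the origin. -/
noncomputable def circleIntegralM {m n : ℕ} (ρ : ℝ) (F : ℂ → Matrix (Fin m) (Fin n) ℂ) :
    Matrix (Fin m) (Fin n) ℂ :=
  Matrix.of fun i j => circleIntegral (fun z => F z i j) 0 ρ

/-- `R` is a (matrix-valued) left reproducing kernel of order `N` for the weight `W` on
the circle `|z| = ρ`. -/
def IsLeftRKCircleM (r N : ℕ) (ρ : ℝ) (W : ℂ → Matrix (Fin r) (Fin r) ℂ)
    (R : ℂ → ℂ → Matrix (Fin r) (Fin r) ℂ) : Prop :=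
  (∀ z : ℂ, IsMatPoly r r (N - 1) fun w => R w z) ∧
  (∀ w : ℂ, IsMatPoly r r (N - 1) fun z => R w z) ∧
  ∀ P : ℂ → Matrix (Fin r) (Fin r) ℂ, IsMatPoly r r (N - 1) P →
    ∀ z : ℂ, circleIntegralM ρ (fun w => P w * W w * R w z) = P z

/-- `K` is a scalar left reproducing kernel of order `N` for the weight `W` on the circle
`|z| = ρ`. -/
def IsLeftRKCircleS (N : ℕ) (ρ : ℝ) (W : ℂ → ℂ) (K : ℂ → ℂ → ℂ) : Prop :=
  (∀ z : ℂ, IsPolyDeg (N - 1) fun w => K w z) ∧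
  (∀ w : ℂ, IsPolyDeg (N - 1) (K w)) ∧
  ∀ p : ℂ → ℂ, IsPolyDeg (N - 1) p →
    ∀ z : ℂ, circleIntegral (fun w => p w * W w * K w z) 0 ρ = p z


lemma ne_zero_of_mem_sphere_zero {ρ : ℝ} (hρ : 0 < ρ) {z : ℂ}
    (hz : z ∈ Metric.sphere (0 : ℂ) ρ) : z ≠ 0 := by
  rintro rfl
  simp only [mem_sphere_zero_iff_norm, norm_zero] at hz
  exact hρ.ne hz

lemma quadratic_ne_zero_of_mem_sphere {b c : ℂ} {ρ : ℝ} (hb : ‖b‖ < ρ) (hc : c ≠ 0) {ζ : ℂ}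
    (hζ : ζ ∈ Metric.sphere (0 : ℂ) ρ) : (ζ ^ 2 - b ^ 2) / (2 * c) ≠ 0 := by
  refine div_ne_zero (fun h => ?_) (by simpa using hc)
  have h1 : ‖ζ‖ ^ 2 = ‖b‖ ^ 2 := by rw [← norm_pow, ← norm_pow, sub_eq_zero.mp h]
  rw [mem_sphere_zero_iff_norm.mp hζ] at h1
  nlinarith [norm_nonneg b]

lemma continuousOn_zpow_sphere (j : ℤ) {ρ : ℝ} (hρ : 0 < ρ) :
    ContinuousOn (fun z : ℂ => z ^ j) (Metric.sphere 0 ρ) :=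
  continuousOn_id.zpow₀ j fun _ hz => Or.inl (ne_zero_of_mem_sphere_zero hρ hz)

lemma circleIntegral_comp_neg (f : ℂ → ℂ) (R : ℝ) :
    circleIntegral (fun z => f (-z)) 0 R = -circleIntegral f 0 R := by
  have hper : Function.Periodic
      (fun θ : ℝ => deriv (circleMap 0 R) θ • f (circleMap 0 R θ)) (2 * Real.pi) := by
    intro θ
    simp [deriv_circleMap, periodic_circleMap 0 R θ]
  have hneg : ∀ θ : ℝ, circleMap 0 R (θ + Real.pi) = -circleMap 0 R θ := by
    intro θ
    simp [circleMap, add_mul, Complex.exp_add]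
  have h1 := hper.intervalIntegral_add_eq Real.pi 0
  have h2 := intervalIntegral.integral_comp_add_right (a := 0) (b := 2 * Real.pi)
    (fun θ : ℝ => deriv (circleMap 0 R) θ • f (circleMap 0 R θ)) Real.pi
  simp only [zero_add] at h1 h2
  rw [add_comm (2 * Real.pi) Real.pi, h1] at h2
  unfold circleIntegral
  rw [← h2, ← intervalIntegral.integral_neg]
  refine intervalIntegral.integral_congr fun θ _ => ?_
  simp [deriv_circleMap, hneg]

lemma circleIntegral_zpow_comp_quadratic {b c : ℂ} {ρ : ℝ} (hb : ‖b‖ < ρ) (hc : c ≠ 0) (j : ℤ) :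
    circleIntegral (fun ζ => ((ζ ^ 2 - b ^ 2) / (2 * c)) ^ j * (ζ / c)) 0 ρ =
      2 * circleIntegral (fun z => z ^ j) 0 1 := by
  have hρ : 0 < ρ := (norm_nonneg b).trans_lt hb
  have hm : ∀ ζ ∈ Metric.sphere (0 : ℂ) ρ, ζ - b ≠ 0 := by
    rintro ζ hζ h
    rw [sub_eq_zero] at h
    rw [mem_sphere_zero_iff_norm, h] at hζ
    exact hb.ne hζ
  have hp : ∀ ζ ∈ Metric.sphere (0 : ℂ) ρ, ζ - -b ≠ 0 := by
    rintro ζ hζ h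
    rw [sub_eq_zero] at h
    rw [mem_sphere_zero_iff_norm, h, norm_neg] at hζ
    exact hb.ne hζ
  by_cases hj : j = -1
  · subst hj
    have hR : circleIntegral (fun z : ℂ => z ^ (-1 : ℤ)) 0 1 = 2 * Real.pi * Complex.I := by
      simpa using circleIntegral.integral_sub_inv_of_mem_ball
        (c := (0 : ℂ)) (w := 0) (R := 1) (by simp)
    have hL : circleIntegral (fun ζ => ((ζ ^ 2 - b ^ 2) / (2 * c)) ^ (-1 : ℤ) * (ζ / c)) 0 ρ =
        circleIntegral (fun ζ => (ζ - b)⁻¹ + (ζ - -b)⁻¹) 0 ρ := by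
      refine circleIntegral.integral_congr hρ.le fun ζ hζ => ?_
      have h1 := hm ζ hζ
      have h2 := hp ζ hζ
      have h3 : ζ ^ 2 - b ^ 2 ≠ 0 := by
        rw [show ζ ^ 2 - b ^ 2 = (ζ - b) * (ζ - -b) by ring]
        exact mul_ne_zero h1 h2
      simp only [zpow_neg, zpow_one]
      field_simp
      ring
    rw [hL, hR, circleIntegral.integral_add,
      circleIntegral.integral_sub_inv_of_mem_ball (by simpa using hb),
      circleIntegral.integral_sub_inv_of_mem_ball (by simpa using hb)]
    · ring
    · refine ContinuousOn.circleIntegrable hρ.le ?_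
      exact ContinuousOn.inv₀ (by fun_prop) hm
    · refine ContinuousOn.circleIntegrable hρ.le ?_
      exact ContinuousOn.inv₀ (by fun_prop) hp
  · have hR : circleIntegral (fun z : ℂ => z ^ j) 0 1 = 0 := by
      simpa using circleIntegral.integral_sub_zpow_of_ne hj 0 0 1
    rw [hR, mul_zero]
    have hj' : (j : ℂ) + 1 ≠ 0 := by
      intro h
      apply hj
      have : ((j + 1 : ℤ) : ℂ) = 0 := by push_cast; exact h
      have := Int.cast_eq_zero.mp this
      omega
    refine circleIntegral.integral_eq_zero_of_hasDerivWithinAt hρ.le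
      (f := fun ζ => ((ζ ^ 2 - b ^ 2) / (2 * c)) ^ (j + 1) / (j + 1)) fun ζ hζ => ?_
    have h3 := quadratic_ne_zero_of_mem_sphere hb hc hζ
    have hφ : HasDerivAt (fun ζ : ℂ => (ζ ^ 2 - b ^ 2) / (2 * c)) (2 * ζ / (2 * c)) ζ := by
      simpa using ((hasDerivAt_pow 2 ζ).sub_const (b ^ 2)).div_const (2 * c)
    have hz := ((hasDerivAt_zpow (j + 1) _ (Or.inl h3)).comp ζ hφ).div_const ((j : ℂ) + 1)
    refine HasDerivAt.hasDerivWithinAt ?_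
    refine hz.congr_deriv ?_
    push_cast
    rw [add_sub_cancel_right]
    field_simp

open Polynomial in
lemma circleIntegral_laurent_comp_quadratic {b c : ℂ} {ρ : ℝ} (hb : ‖b‖ < ρ) (hc : c ≠ 0)
    (j : ℤ) (P : ℂ[X]) :
    circleIntegral (fun ζ => ((ζ ^ 2 - b ^ 2) / (2 * c)) ^ j * (ζ / c) *
        P.eval ((ζ ^ 2 - b ^ 2) / (2 * c))) 0 ρ =
      2 * circleIntegral (fun z => z ^ j * P.eval z) 0 1 := by
  have hρ : 0 < ρ := (norm_nonneg b).trans_lt hb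
  have h0 : ∀ ζ ∈ Metric.sphere (0 : ℂ) ρ, (ζ ^ 2 - b ^ 2) / (2 * c) ≠ 0 :=
    fun ζ => quadratic_ne_zero_of_mem_sphere hb hc
  have c1 : ∀ P : ℂ[X], CircleIntegrable (fun ζ => ((ζ ^ 2 - b ^ 2) / (2 * c)) ^ j * (ζ / c) *
        P.eval ((ζ ^ 2 - b ^ 2) / (2 * c))) 0 ρ := by
    intro P
    refine ContinuousOn.circleIntegrable hρ.le ?_
    refine ContinuousOn.mul (ContinuousOn.mul ?_ (by fun_prop)) (by fun_prop)
    exact ContinuousOn.zpow₀ (by fun_prop) j fun ζ hζ => Or.inl (h0 ζ hζ)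
  have c2 : ∀ P : ℂ[X], CircleIntegrable (fun z => z ^ j * P.eval z) 0 1 := by
    intro P
    refine ContinuousOn.circleIntegrable zero_le_one ?_
    exact (continuousOn_zpow_sphere j one_pos).mul (by fun_prop)
  induction P using Polynomial.induction_on' with
  | add p q hp hq =>
    simp only [eval_add, mul_add]
    rw [circleIntegral.integral_add (c1 p) (c1 q), circleIntegral.integral_add (c2 p) (c2 q),
      hp, hq, mul_add]
  | monomial k a =>
    have h := circleIntegral_zpow_comp_quadratic hb hc (j + k)
    have e1 : circleIntegral (fun ζ => ((ζ ^ 2 - b ^ 2) / (2 * c)) ^ j * (ζ / c) *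
        (monomial k a).eval ((ζ ^ 2 - b ^ 2) / (2 * c))) 0 ρ =
        circleIntegral (fun ζ => a * (((ζ ^ 2 - b ^ 2) / (2 * c)) ^ (j + k) * (ζ / c))) 0 ρ := by
      refine circleIntegral.integral_congr hρ.le fun ζ hζ => ?_
      simp only [eval_monomial]
      rw [zpow_add₀ (h0 ζ hζ), zpow_natCast]
      ring
    have e2 : circleIntegral (fun z => z ^ j * (monomial k a).eval z) 0 1 =
        circleIntegral (fun z => a * z ^ (j + k)) 0 1 := by
      refine circleIntegral.integral_congr zero_le_one fun z hz => ?_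
      simp only [eval_monomial]
      rw [zpow_add₀ (ne_zero_of_mem_sphere_zero one_pos hz), zpow_natCast]
      ring
    rw [e1, e2, circleIntegral.integral_const_mul, circleIntegral.integral_const_mul, h]
    ring

section CircleIntegralM

lemma ContinuousOn.matrix_elem {X R m n : Type*} [TopologicalSpace X] [TopologicalSpace R]
    {F : X → Matrix m n R} {s : Set X} (hF : ContinuousOn F s) (i : m) (j : n) :
    ContinuousOn (fun x => F x i j) s :=
  (continuous_id.matrix_elem i j).comp_continuousOn hF

variable {l m n : ℕ} {ρ : ℝ}

lemma circleIntegralM_apply (F : ℂ → Matrix (Fin m) (Fin n) ℂ) (i : Fin m) (j : Fin n) :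
    circleIntegralM ρ F i j = circleIntegral (fun z => F z i j) 0 ρ := rfl

lemma circleIntegralM_congr (hρ : 0 ≤ ρ) {F G : ℂ → Matrix (Fin m) (Fin n) ℂ}
    (h : ∀ z ∈ Metric.sphere (0 : ℂ) ρ, F z = G z) :
    circleIntegralM ρ F = circleIntegralM ρ G := by
  ext i j
  exact circleIntegral.integral_congr hρ fun z hz => congrFun (congrFun (h z hz) i) j

lemma circleIntegralM_smul (a : ℂ) (F : ℂ → Matrix (Fin m) (Fin n) ℂ) :
    circleIntegralM ρ (fun z => a • F z) = a • circleIntegralM ρ F := by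
  ext i j
  exact circleIntegral.integral_const_mul a (fun z => F z i j) 0 ρ

lemma circleIntegralM_finset_sum (hρ : 0 ≤ ρ) {ι : Type*} (s : Finset ι)
    {F : ι → ℂ → Matrix (Fin m) (Fin n) ℂ}
    (h : ∀ i ∈ s, ContinuousOn (F i) (Metric.sphere 0 ρ)) :
    circleIntegralM ρ (fun z => ∑ i ∈ s, F i z) = ∑ i ∈ s, circleIntegralM ρ (F i) := by
  ext i j
  simp only [circleIntegralM_apply, Matrix.sum_apply]
  exact circleIntegral.integral_fun_sum fun k hk =>
    (((h k hk).matrix_elem i j)).circleIntegrable hρ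

lemma circleIntegralM_const_mul (hρ : 0 ≤ ρ) (B : Matrix (Fin l) (Fin m) ℂ)
    {F : ℂ → Matrix (Fin m) (Fin n) ℂ} (hF : ContinuousOn F (Metric.sphere 0 ρ)) :
    circleIntegralM ρ (fun z => B * F z) = B * circleIntegralM ρ F := by
  ext i j
  simp only [circleIntegralM_apply, Matrix.mul_apply]
  rw [circleIntegral.integral_fun_sum]
  · simp only [circleIntegral.integral_const_mul]
  · intro k _
    exact (continuousOn_const.mul (hF.matrix_elem k j)).circleIntegrable hρ

lemma circleIntegralM_mul_const (hρ : 0 ≤ ρ) (B : Matrix (Fin n) (Fin l) ℂ)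
    {F : ℂ → Matrix (Fin m) (Fin n) ℂ} (hF : ContinuousOn F (Metric.sphere 0 ρ)) :
    circleIntegralM ρ (fun z => F z * B) = circleIntegralM ρ F * B := by
  ext i j
  simp only [circleIntegralM_apply, Matrix.mul_apply]
  rw [circleIntegral.integral_fun_sum]
  · refine Finset.sum_congr rfl fun k _ => ?_
    simp only [mul_comm _ (B k j), circleIntegral.integral_const_mul]
  · intro k _
    exact ((hF.matrix_elem i k).mul continuousOn_const).circleIntegrable hρ

end CircleIntegralM

section MatrixPolynomialFunctions

open Polynomial

/-- Matrix-valued functions whose entries are polynomial functions. -/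
def IsMatPolyFun (r : ℕ) (F : ℂ → Matrix (Fin r) (Fin r) ℂ) : Prop :=
  ∃ P : Matrix (Fin r) (Fin r) ℂ[X], ∀ z, F z = (evalRingHom z).mapMatrix P

variable {r : ℕ} {F G : ℂ → Matrix (Fin r) (Fin r) ℂ}

lemma IsMatPolyFun.of_entries (h : ∀ i j, ∃ p : ℂ[X], ∀ z, F z i j = p.eval z) :
    IsMatPolyFun r F := by
  choose P hP using h
  exact ⟨Matrix.of P, fun z => by ext i j; simp [hP]⟩

lemma IsMatPolyFun.const (B : Matrix (Fin r) (Fin r) ℂ) : IsMatPolyFun r fun _ => B :=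
  .of_entries fun i j => ⟨C (B i j), by simp⟩

lemma IsMatPolyFun.mul (hF : IsMatPolyFun r F) (hG : IsMatPolyFun r G) :
    IsMatPolyFun r fun z => F z * G z := by
  obtain ⟨P, hP⟩ := hF
  obtain ⟨Q, hQ⟩ := hG
  exact ⟨P * Q, fun z => by simp only [map_mul, hP, hQ]⟩

lemma IsMatPolyFun.pow (hF : IsMatPolyFun r F) (k : ℕ) : IsMatPolyFun r fun z => F z ^ k := by
  obtain ⟨P, hP⟩ := hF
  exact ⟨P ^ k, fun z => by simp only [map_pow, hP]⟩

lemma IsMatPolyFun.sum {ι : Type*} (s : Finset ι) {F : ι → ℂ → Matrix (Fin r) (Fin r) ℂ}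
    (h : ∀ i ∈ s, IsMatPolyFun r (F i)) : IsMatPolyFun r fun z => ∑ i ∈ s, F i z := by
  choose! P hP using h
  exact ⟨∑ i ∈ s, P i, fun z => by
    rw [map_sum]; exact Finset.sum_congr rfl fun i hi => hP i hi z⟩

lemma IsMatPolyFun.eval_smul (p : ℂ[X]) (B : Matrix (Fin r) (Fin r) ℂ) :
    IsMatPolyFun r fun z => p.eval z • B :=
  .of_entries fun i j => ⟨p * C (B i j), by simp⟩

lemma IsMatPolyFun.continuous (hF : IsMatPolyFun r F) : Continuous F := by
  obtain ⟨P, hP⟩ := hF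
  refine continuous_matrix fun i j => ?_
  simp only [hP]
  simpa using (P i j).continuous

lemma IsMatPoly.entry {m n d : ℕ} {F : ℂ → Matrix (Fin m) (Fin n) ℂ} (hF : IsMatPoly m n d F)
    (i : Fin m) (j : Fin n) :
    ∃ p : ℂ[X], p.natDegree ≤ d ∧ ∀ z, F z i j = p.eval z := by
  obtain ⟨c, hc⟩ := hF
  refine ⟨∑ k ∈ Finset.range (d + 1), monomial k (c k i j), ?_, fun z => ?_⟩
  · refine natDegree_sum_le_of_forall_le _ _ fun k hk => (natDegree_monomial_le _).trans ?_
    have := Finset.mem_range.mp hk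
    omega
  · rw [hc, Matrix.sum_apply, eval_finsetSum]
    exact Finset.sum_congr rfl fun k _ => by simp [mul_comm]

lemma IsMatPoly.of_entries {m n d : ℕ} {F : ℂ → Matrix (Fin m) (Fin n) ℂ}
    (h : ∀ i j, ∃ p : ℂ[X], p.natDegree ≤ d ∧ ∀ z, F z i j = p.eval z) : IsMatPoly m n d F := by
  choose P hd hP using h
  refine ⟨fun k => Matrix.of fun i j => (P i j).coeff k, fun z => ?_⟩
  ext i j
  rw [hP, Matrix.sum_apply, eval_eq_sum_range' (Nat.lt_succ_of_le (hd i j))]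
  exact Finset.sum_congr rfl fun k _ => by simp [mul_comm]

lemma IsMatPoly.isMatPolyFun {d : ℕ} (hF : IsMatPoly r r d F) : IsMatPolyFun r F :=
  .of_entries fun i j => let ⟨p, _, hp⟩ := hF.entry i j; ⟨p, hp⟩

lemma isPolyDeg_of_eval {d : ℕ} {f : ℂ → ℂ} {p : ℂ[X]} (hd : p.natDegree ≤ d)
    (hp : ∀ z, f z = p.eval z) : IsPolyDeg d f :=
  ⟨p.coeff, fun z => by rw [hp, eval_eq_sum_range' (Nat.lt_succ_of_le hd)]⟩

lemma IsMatPoly.eq_sum_interpolation {m n d : ℕ} {F : ℂ → Matrix (Fin m) (Fin n) ℂ}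
    (hF : IsMatPoly m n d F) (z : ℂ) :
    F z = ∑ k ∈ Finset.range (d + 1),
      (Lagrange.basis (Finset.range (d + 1)) (fun k : ℕ => (k : ℂ)) k).eval z • F k := by
  ext i j
  obtain ⟨p, hd, hp⟩ := hF.entry i j
  have hdeg : p.degree < (Finset.range (d + 1)).card := by
    rw [Finset.card_range]
    exact degree_le_natDegree.trans_lt (by exact_mod_cast Nat.lt_succ_of_le hd)
  have := Lagrange.eq_interpolate (s := Finset.range (d + 1)) (v := fun k : ℕ => (k : ℂ))
    (fun a _ b _ h => by simpa using h) hdeg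
  rw [hp, this, Lagrange.interpolate_apply, eval_finsetSum, Matrix.sum_apply]
  exact Finset.sum_congr rfl fun k _ => by simp [hp, mul_comm]

end MatrixPolynomialFunctions

/-- Change of variables between the spectral curve of a matrix polynomial and the base: `E` is the
spectral projection belonging to the eigenvalue `lam` and `z = (ζ ^ 2 - b ^ 2) / (2 * c)`. -/
lemma circleIntegralM_spectral {b c : ℂ} {ρ : ℝ} (hb : ‖b‖ < ρ) (hc : c ≠ 0)
    {A E X Y : ℂ → Matrix (Fin 2) (Fin 2) ℂ} {lam φ : ℂ → ℂ}
    (hφ : ∀ ζ, φ ζ = (ζ ^ 2 - b ^ 2) / (2 * c))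
    (hlam : Continuous lam) (hE : ContinuousOn E (Metric.sphere 0 ρ))
    (hE1 : ∀ ζ, ζ ≠ 0 → E ζ + E (-ζ) = 1) (hAE : ∀ ζ, ζ ≠ 0 → A (φ ζ) * E ζ = lam ζ • E ζ)
    (hA : IsMatPolyFun 2 A) (hX : IsMatPolyFun 2 X) (hY : IsMatPolyFun 2 Y) (k : ℕ) (j : ℤ) :
    circleIntegralM ρ (fun ζ => (lam ζ ^ k * φ ζ ^ j * (ζ / c)) • (X (φ ζ) * E ζ * Y (φ ζ))) =
      circleIntegralM 1 (fun z => z ^ j • (X z * A z ^ k * Y z)) := by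
  have hρ : 0 < ρ := (norm_nonneg b).trans_lt hb
  have h0 : ∀ ζ ∈ Metric.sphere (0 : ℂ) ρ, ζ ≠ 0 :=
    fun ζ => ne_zero_of_mem_sphere_zero hρ
  have hφ0 : ∀ ζ ∈ Metric.sphere (0 : ℂ) ρ, φ ζ ≠ 0 := by
    intro ζ hζ
    rw [hφ]
    exact quadratic_ne_zero_of_mem_sphere hb hc hζ
  have hφc : Continuous φ := by
    rw [funext hφ]
    fun_prop
  have hφe : ∀ ζ, φ (-ζ) = φ ζ := fun ζ => by simp [hφ]
  have hpow : ∀ ζ, ζ ≠ 0 → A (φ ζ) ^ k * E ζ = lam ζ ^ k • E ζ := by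
    intro ζ hζ
    induction k with
    | zero => simp
    | succ k ih =>
      rw [pow_succ, mul_assoc, hAE ζ hζ, mul_smul_comm, ih, smul_smul, pow_succ, mul_comm]
  obtain ⟨P, hP⟩ := (hX.mul (hA.pow k)).mul hY
  beta_reduce at hP
  have hcont : ContinuousOn
      (fun ζ => (lam ζ ^ k * φ ζ ^ j * (ζ / c)) • (X (φ ζ) * E ζ * Y (φ ζ)))
      (Metric.sphere 0 ρ) := by
    refine ContinuousOn.fun_smul (ContinuousOn.mul (ContinuousOn.mul ?_ ?_)
      (continuous_id.div_const c).continuousOn)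
      (((hX.continuous.comp hφc).continuousOn.mul hE).mul
        (hY.continuous.comp hφc).continuousOn)
    · exact (hlam.pow k).continuousOn
    · exact ContinuousOn.zpow₀ hφc.continuousOn j fun ζ hζ => Or.inl (hφ0 ζ hζ)
  ext a d
  simp only [circleIntegralM_apply]
  have hint := ((hcont.matrix_elem a d)).circleIntegrable hρ.le
  set f : ℂ → ℂ := fun ζ =>
    ((lam ζ ^ k * φ ζ ^ j * (ζ / c)) • (X (φ ζ) * E ζ * Y (φ ζ))) a d with hf
  have hcont' : ContinuousOn (fun ζ => f (-ζ)) (Metric.sphere 0 ρ) := by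
    refine (hcont.matrix_elem a d).comp continuous_neg.continuousOn fun ζ hζ => ?_
    simpa using hζ
  have hsub : circleIntegral (fun ζ => f ζ - f (-ζ)) 0 ρ = 2 * circleIntegral f 0 ρ := by
    rw [circleIntegral.integral_sub hint (hcont'.circleIntegrable hρ.le),
      circleIntegral_comp_neg]
    ring
  have hcov := circleIntegral_laurent_comp_quadratic hb hc j (P a d)
  have hL : circleIntegral (fun ζ => f ζ - f (-ζ)) 0 ρ =
      circleIntegral (fun ζ => ((ζ ^ 2 - b ^ 2) / (2 * c)) ^ j * (ζ / c) *
        (P a d).eval ((ζ ^ 2 - b ^ 2) / (2 * c))) 0 ρ := by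
    refine circleIntegral.integral_congr hρ.le fun ζ hζ => ?_
    have hz := h0 ζ hζ
    have key : (lam ζ ^ k * φ ζ ^ j * (ζ / c)) • (X (φ ζ) * E ζ * Y (φ ζ)) -
        (lam (-ζ) ^ k * φ (-ζ) ^ j * (-ζ / c)) • (X (φ (-ζ)) * E (-ζ) * Y (φ (-ζ))) =
        (φ ζ ^ j * (ζ / c)) • (X (φ ζ) * A (φ ζ) ^ k * Y (φ ζ)) := by
      have hs : A (φ ζ) ^ k = lam ζ ^ k • E ζ + lam (-ζ) ^ k • E (-ζ) := by
        have h2 := hpow (-ζ) (neg_ne_zero.mpr hz)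
        rw [hφe] at h2
        rw [← hpow ζ hz, ← h2, ← mul_add, hE1 ζ hz, mul_one]
      rw [hφe, hs, mul_add, add_mul, smul_add]
      simp only [mul_smul_comm, smul_mul_assoc, smul_smul]
      rw [sub_eq_add_neg, ← neg_smul]
      congr 2 <;> ring
    have key' := congrFun (congrFun key a) d
    rw [hP] at key'
    simpa [hf, hφ] using key'
  have hR : circleIntegral (fun z => (z ^ j • (X z * A z ^ k * Y z)) a d) 0 1 =
      circleIntegral (fun z => z ^ j * (P a d).eval z) 0 1 := by
    refine circleIntegral.integral_congr zero_le_one fun z _ => ?_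
    simp [hP]
  rw [hR]
  refine mul_left_cancel₀ (two_ne_zero (α := ℂ)) ?_
  rw [← hcov, ← hL, hsub]

lemma circleIntegralM_spectral_spectral {b c : ℂ} {ρ : ℝ} (hb : ‖b‖ < ρ) (hc : c ≠ 0)
    {A E X Y : ℂ → Matrix (Fin 2) (Fin 2) ℂ} {lam φ : ℂ → ℂ}
    (hφ : ∀ ζ, φ ζ = (ζ ^ 2 - b ^ 2) / (2 * c))
    (hlam : Continuous lam) (hE : ContinuousOn E (Metric.sphere 0 ρ))
    (hE1 : ∀ ζ, ζ ≠ 0 → E ζ + E (-ζ) = 1) (hAE : ∀ ζ, ζ ≠ 0 → A (φ ζ) * E ζ = lam ζ • E ζ)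
    (hA : IsMatPolyFun 2 A) (hX : IsMatPolyFun 2 X) (hY : IsMatPolyFun 2 Y)
    {K : ℂ → ℂ → Matrix (Fin 2) (Fin 2) ℂ} {N : ℕ}
    (hK1 : ∀ z, IsMatPoly 2 2 N fun w => K w z) (hK2 : ∀ w, IsMatPoly 2 2 N fun z => K w z)
    (k k' : ℕ) (j j' : ℤ) :
    circleIntegralM ρ (fun ω => circleIntegralM ρ (fun ζ =>
        ((lam ω ^ k * φ ω ^ j * (ω / c)) * (lam ζ ^ k' * φ ζ ^ j' * (ζ / c))) •
          (X (φ ω) * E ω * K (φ ω) (φ ζ) * E ζ * Y (φ ζ)))) =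
      circleIntegralM 1 (fun w => circleIntegralM 1 (fun z =>
        (w ^ j * z ^ j') • (X w * A w ^ k * K w z * A z ^ k' * Y z))) := by
  have hρ : 0 < ρ := (norm_nonneg b).trans_lt hb
  have hφ0 : ∀ ζ ∈ Metric.sphere (0 : ℂ) ρ, φ ζ ≠ 0 := by
    intro ζ hζ
    rw [hφ]
    exact quadratic_ne_zero_of_mem_sphere hb hc hζ
  have hφc : Continuous φ := by
    rw [funext hφ]
    fun_prop
  have hKp : ∀ w, IsMatPolyFun 2 fun z => K w z := fun w => (hK2 w).isMatPolyFun
  set B : ℂ → Matrix (Fin 2) (Fin 2) ℂ := fun w =>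
    circleIntegralM 1 (fun z => z ^ j' • (K w z * A z ^ k' * Y z)) with hB
  have hcz : ∀ w, ContinuousOn (fun z : ℂ => z ^ j' • (K w z * A z ^ k' * Y z))
      (Metric.sphere 0 1) := by
    intro w
    exact (continuousOn_zpow_sphere j' one_pos).fun_smul
      (((hKp w).mul (hA.pow k')).mul hY).continuous.continuousOn
  have hcζ : ∀ w, ContinuousOn
      (fun ζ => (lam ζ ^ k' * φ ζ ^ j' * (ζ / c)) • (K w (φ ζ) * E ζ * Y (φ ζ)))
      (Metric.sphere 0 ρ) := by
    intro w
    refine ContinuousOn.fun_smul (ContinuousOn.mul (ContinuousOn.mul ?_ ?_)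
      (continuous_id.div_const c).continuousOn)
      ((((hKp w).continuous.comp hφc).continuousOn.mul hE).mul
        (hY.continuous.comp hφc).continuousOn)
    · exact (hlam.pow k').continuousOn
    · exact ContinuousOn.zpow₀ hφc.continuousOn j' fun ζ hζ => Or.inl (hφ0 ζ hζ)
  have hBp : IsMatPolyFun 2 B := by
    have hBs : B = fun w => ∑ i ∈ Finset.range (N + 1),
        (Lagrange.basis (Finset.range (N + 1)) (fun i : ℕ => (i : ℂ)) i).eval w • B i := by
      funext w
      simp only [hB, ← circleIntegralM_smul]
      rw [← circleIntegralM_finset_sum zero_le_one _ fun (i : ℕ) _ =>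
        (hcz (i : ℂ)).fun_const_smul _]
      refine circleIntegralM_congr zero_le_one fun z _ => ?_
      rw [(hK1 z).eq_sum_interpolation w, Finset.sum_mul, Finset.sum_mul, Finset.smul_sum]
      refine Finset.sum_congr rfl fun i _ => ?_
      rw [smul_mul_assoc, smul_mul_assoc, smul_comm]
    rw [hBs]
    exact IsMatPolyFun.sum _ fun i _ => .eval_smul _ _
  have hinnerL : ∀ w, circleIntegralM 1 (fun z =>
      (w ^ j * z ^ j') • (X w * A w ^ k * K w z * A z ^ k' * Y z)) =
      w ^ j • (X w * A w ^ k * B w) := by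
    intro w
    rw [hB, ← circleIntegralM_const_mul zero_le_one _ (hcz w), ← circleIntegralM_smul]
    refine circleIntegralM_congr zero_le_one fun z _ => ?_
    rw [mul_smul_comm, smul_smul]
    simp only [mul_assoc]
  have hinnerR : ∀ ω, circleIntegralM ρ (fun ζ =>
        ((lam ω ^ k * φ ω ^ j * (ω / c)) * (lam ζ ^ k' * φ ζ ^ j' * (ζ / c))) •
          (X (φ ω) * E ω * K (φ ω) (φ ζ) * E ζ * Y (φ ζ))) =
      (lam ω ^ k * φ ω ^ j * (ω / c)) • (X (φ ω) * E ω * B (φ ω)) := by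
    intro ω
    have h := circleIntegralM_spectral hb hc hφ hlam hE hE1 hAE hA (hKp (φ ω)) hY k' j'
    rw [hB]
    beta_reduce
    rw [← h, ← circleIntegralM_const_mul hρ.le _ (hcζ (φ ω)), ← circleIntegralM_smul]
    refine circleIntegralM_congr hρ.le fun ζ _ => ?_
    rw [mul_smul_comm, smul_smul]
    simp only [mul_assoc]
  simp only [hinnerL, hinnerR]
  exact circleIntegralM_spectral hb hc hφ hlam hE hE1 hAE hA hX hBp k j

/-- The rank-one projection `u ζ * v ζ` onto the eigenline indexed by the point `ζ` of the
spectral curve. -/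
noncomputable def spectralProj (b d ζ : ℂ) : Matrix (Fin 2) (Fin 2) ℂ :=
  Matrix.vecMulVec ![1, (ζ + b) / (2 * d)] ![(ζ - b) / (2 * ζ), d / ζ]

lemma spectralProj_eq (b d ζ : ℂ) : spectralProj b d ζ =
    !![(ζ - b) / (2 * ζ), d / ζ; (ζ + b) / (2 * d) * ((ζ - b) / (2 * ζ)),
      (ζ + b) / (2 * d) * (d / ζ)] := by
  ext i j
  fin_cases i <;> fin_cases j <;> simp [spectralProj, Matrix.vecMulVec_apply]

lemma continuousOn_spectralProj (b d : ℂ) {s : Set ℂ} (hs : ∀ ζ ∈ s, ζ ≠ 0) :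
    ContinuousOn (spectralProj b d) s := by
  have h1 : ContinuousOn (fun ζ : ℂ => (ζ - b) / (2 * ζ)) s :=
    ContinuousOn.div (by fun_prop) (by fun_prop) fun ζ hζ => mul_ne_zero two_ne_zero (hs ζ hζ)
  have h2 : ContinuousOn (fun ζ : ℂ => d / ζ) s :=
    ContinuousOn.div (by fun_prop) (by fun_prop) hs
  have h3 : ContinuousOn (fun ζ : ℂ => (ζ + b) / (2 * d)) s := by fun_prop
  refine continuousOn_pi.mpr fun i => continuousOn_pi.mpr fun j => ?_
  simp only [spectralProj_eq]
  fin_cases i <;> fin_cases j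
  · simpa using h1
  · simpa using h2
  · simpa using h3.fun_mul h1
  · simpa using h3.fun_mul h2

lemma spectralProj_add_neg {b d ζ : ℂ} (hd : d ≠ 0) (hζ : ζ ≠ 0) :
    spectralProj b d ζ + spectralProj b d (-ζ) = 1 := by
  ext i j
  fin_cases i <;> fin_cases j <;> simp [spectralProj_eq] <;> field_simp <;> ring

lemma IsPolyDeg.add {N : ℕ} {f g : ℂ → ℂ} (hf : IsPolyDeg N f) (hg : IsPolyDeg N g) :
    IsPolyDeg N fun z => f z + g z := by
  obtain ⟨a, ha⟩ := hf
  obtain ⟨b, hb⟩ := hg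
  exact ⟨a + b, fun z => by simp [ha, hb, add_mul, Finset.sum_add_distrib]⟩

open Polynomial in
lemma isPolyDeg_linear_mul_comp_quadratic {n : ℕ} (hn : 1 ≤ n) {p : ℂ[X]}
    (hp : p.natDegree ≤ n - 1) (b c α β : ℂ) :
    IsPolyDeg (2 * n - 1) fun ω => (α * ω + β) * p.eval ((ω ^ 2 - b ^ 2) / (2 * c)) := by
  refine isPolyDeg_of_eval (p := (C α * X + C β) * p.comp (C (2 * c)⁻¹ * (X ^ 2 - C (b ^ 2))))
    ?_ fun z => ?_
  · have h1 : (C α * X + C β : ℂ[X]).natDegree ≤ 1 := by compute_degree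
    have h2 : (C (2 * c)⁻¹ * (X ^ 2 - C (b ^ 2)) : ℂ[X]).natDegree ≤ 2 := by compute_degree
    have h3 := natDegree_comp_le.trans (Nat.mul_le_mul hp h2)
    exact (natDegree_mul_le_of_le h1 h3).trans (by omega)
  · simp [div_eq_inv_mul]

open Polynomial in
/-- A polynomial in `ω` of degree at most `2 * n - 1` is `q * u ω` for a row vector `q` of
polynomials of degree at most `n - 1` in `(ω ^ 2 - b ^ 2) / (2 * c)`. -/
lemma IsPolyDeg.exists_eval_quadratic {n : ℕ} (hn : 1 ≤ n) {f : ℂ → ℂ}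
    (hf : IsPolyDeg (2 * n - 1) f) (b : ℂ) {c d : ℂ} (hc : c ≠ 0) (hd : d ≠ 0) :
    ∃ q₀ q₁ : ℂ[X], q₀.natDegree ≤ n - 1 ∧ q₁.natDegree ≤ n - 1 ∧ ∀ ω,
      f ω = q₀.eval ((ω ^ 2 - b ^ 2) / (2 * c)) +
        q₁.eval ((ω ^ 2 - b ^ 2) / (2 * c)) * ((ω + b) / (2 * d)) := by
  obtain ⟨a, ha⟩ := hf
  have hdeg : ∀ e : ℕ → ℂ,
      (∑ k ∈ Finset.range n, C (e k) * (C (2 * c) * X + C (b ^ 2)) ^ k).natDegree ≤ n - 1 := by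
    intro e
    refine natDegree_sum_le_of_forall_le _ _ fun k hk => ?_
    have hl : (C (2 * c) * X + C (b ^ 2) : ℂ[X]).natDegree ≤ 1 := by compute_degree
    have := Finset.mem_range.mp hk
    exact ((natDegree_C_mul_le _ _).trans (natDegree_pow_le_of_le k hl)).trans (by omega)
  refine ⟨_, _, hdeg fun k => a (2 * k) - b * a (2 * k + 1), hdeg fun k => 2 * d * a (2 * k + 1),
    fun ω => ?_⟩
  have hsplit : ∀ (g : ℕ → ℂ) (N : ℕ), ∑ k ∈ Finset.range (2 * N), g k =
      ∑ k ∈ Finset.range N, (g (2 * k) + g (2 * k + 1)) := by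
    intro g N
    induction N with
    | zero => simp
    | succ N ih =>
      rw [show 2 * (N + 1) = 2 * N + 1 + 1 by ring, Finset.sum_range_succ, Finset.sum_range_succ,
        ih, Finset.sum_range_succ, add_assoc]
  rw [ha, show 2 * n - 1 + 1 = 2 * n by omega, hsplit, eval_finsetSum, eval_finsetSum,
    Finset.sum_mul, ← Finset.sum_add_distrib]
  refine Finset.sum_congr rfl fun k _ => ?_
  have hz : (2 * c) * ((ω ^ 2 - b ^ 2) / (2 * c)) + b ^ 2 = ω ^ 2 := by
    field_simp
    ring
  simp only [eval_mul, eval_pow, eval_add, eval_C, eval_X, hz]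
  field_simp
  ring

lemma isLeftRKCircleS_of_isLeftRKCircleM {b c d : ℂ} {ρ : ℝ} (hb : ‖b‖ < ρ) (hc : c ≠ 0)
    (hd : d ≠ 0) {A : ℂ → Matrix (Fin 2) (Fin 2) ℂ} {lam φ : ℂ → ℂ}
    (hφ : ∀ ζ, φ ζ = (ζ ^ 2 - b ^ 2) / (2 * c)) (hlam : Continuous lam)
    (hAE : ∀ ζ, ζ ≠ 0 → A (φ ζ) * spectralProj b d ζ = lam ζ • spectralProj b d ζ)
    (hA : IsMatPolyFun 2 A) {n : ℕ} (hn : 1 ≤ n) (p : ℕ) (s : ℤ)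
    {K : ℂ → ℂ → Matrix (Fin 2) (Fin 2) ℂ}
    (hK : IsLeftRKCircleM 2 n 1 (fun z => z ^ s • A z ^ p) K) :
    IsLeftRKCircleS (2 * n) ρ (fun ω => lam ω ^ p * φ ω ^ s / c)
      (fun ω ζ => (ω - b) / 2 * (K (φ ω) (φ ζ) 0 0 + K (φ ω) (φ ζ) 0 1 * ((ζ + b) / (2 * d))) +
        d * (K (φ ω) (φ ζ) 1 0 + K (φ ω) (φ ζ) 1 1 * ((ζ + b) / (2 * d)))) := by
  have hρ : 0 < ρ := (norm_nonneg b).trans_lt hb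
  have h0 : ∀ ζ ∈ Metric.sphere (0 : ℂ) ρ, ζ ≠ 0 :=
    fun ζ => ne_zero_of_mem_sphere_zero hρ
  obtain ⟨hK1, hK2, hK3⟩ := hK
  refine ⟨fun ζ => ?_, fun ω => ?_, fun f hf ζ => ?_⟩
  · choose P hP hPe using fun i j => (hK1 (φ ζ)).entry i j
    set t := (ζ + b) / (2 * d)
    convert (((isPolyDeg_linear_mul_comp_quadratic hn (hP 0 0) b c 2⁻¹ (-b / 2)).add
      (isPolyDeg_linear_mul_comp_quadratic hn (hP 0 1) b c (2⁻¹ * t) (-b / 2 * t))).add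
      (isPolyDeg_linear_mul_comp_quadratic hn (hP 1 0) b c 0 d)).add
      (isPolyDeg_linear_mul_comp_quadratic hn (hP 1 1) b c 0 (d * t)) using 2 with ω
    simp only [hPe, ← hφ]
    ring
  · choose P hP hPe using fun i j => (hK2 (φ ω)).entry i j
    convert (((isPolyDeg_linear_mul_comp_quadratic hn (hP 0 0) b c 0 ((ω - b) / 2)).add
      (isPolyDeg_linear_mul_comp_quadratic hn (hP 0 1) b c
        ((ω - b) / 2 * (2 * d)⁻¹) ((ω - b) / 2 * (b / (2 * d))))).add
      (isPolyDeg_linear_mul_comp_quadratic hn (hP 1 0) b c 0 d)).add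
      (isPolyDeg_linear_mul_comp_quadratic hn (hP 1 1) b c
        (d * (2 * d)⁻¹) (d * (b / (2 * d)))) using 2 with ζ
    simp only [hPe, ← hφ]
    ring
  · obtain ⟨q₀, q₁, hq₀, hq₁, hq⟩ := hf.exists_eval_quadratic hn b hc hd
    set Q : ℂ → Matrix (Fin 2) (Fin 2) ℂ := fun z => !![q₀.eval z, q₁.eval z; 0, 0] with hQ
    have hQp : IsMatPoly 2 2 (n - 1) Q := by
      refine .of_entries fun i j => ?_
      fin_cases i <;> fin_cases j
      · exact ⟨q₀, hq₀, fun z => by simp [hQ]⟩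
      · exact ⟨q₁, hq₁, fun z => by simp [hQ]⟩
      · exact ⟨0, by simp, fun z => by simp [hQ]⟩
      · exact ⟨0, by simp, fun z => by simp [hQ]⟩
    set U : Matrix (Fin 2) (Fin 2) ℂ := !![1, 0; (ζ + b) / (2 * d), 0] with hU
    have hKp : IsMatPolyFun 2 fun w => K w (φ ζ) := (hK1 (φ ζ)).isMatPolyFun
    have hsp := circleIntegralM_spectral hb hc hφ hlam (continuousOn_spectralProj b d h0)
      (fun ζ hζ => spectralProj_add_neg hd hζ) hAE hA hQp.isMatPolyFun (hKp.mul (.const U)) p s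
    have hcont : ContinuousOn (fun z : ℂ => Q z * z ^ s • A z ^ p * K z (φ ζ))
        (Metric.sphere 0 1) := by
      exact (hQp.isMatPolyFun.continuous.continuousOn.mul
        ((continuousOn_zpow_sphere s one_pos).fun_smul
          (hA.pow p).continuous.continuousOn)).mul hKp.continuous.continuousOn
    have hR : circleIntegralM 1 (fun z => z ^ s • (Q z * A z ^ p * (K z (φ ζ) * U))) =
        Q (φ ζ) * U := by
      rw [← hK3 Q hQp (φ ζ), ← circleIntegralM_mul_const zero_le_one U hcont]
      refine circleIntegralM_congr zero_le_one fun z _ => ?_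
      simp only [mul_smul_comm, smul_mul_assoc, mul_assoc]
    rw [hR] at hsp
    have hsp' := congrFun (congrFun hsp 0) 0
    have hf' : f ζ = (Q (φ ζ) * U) 0 0 := by
      rw [hq, ← hφ]
      simp [hQ, hU, Matrix.mul_apply, Fin.sum_univ_two]
    rw [hf', ← hsp', circleIntegralM_apply]
    refine circleIntegral.integral_congr hρ.le fun ω hω => ?_
    have hω0 := h0 ω hω
    have hfω := hq ω
    rw [← hφ] at hfω
    simp only [hfω, spectralProj_eq, Matrix.smul_apply, smul_eq_mul, Matrix.mul_apply,
      Fin.sum_univ_two, hQ, hU, Matrix.of_apply, Matrix.cons_val', Matrix.cons_val_zero,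
      Matrix.cons_val_one, Matrix.cons_val_fin_one]
    generalize K (φ ω) (φ ζ) = M
    field_simp

/-- The correlation kernel of a lozenge tiling model with a `2 × 2`
periodic weighting in the degenerate case `a₋ = 0`: the matrix-valued double contour
integral formula equals a formula involving only the scalar reproducing kernel `𝒦` for
the weight `𝒲` on the circle of radius `ρ`. -/
theorem stmt17 (a00 a01 a10 a11 b00 b01 b10 b11 : ℝ)
    (ha00 : 0 < a00) (ha01 : 0 < a01) (ha10 : 0 < a10) (ha11 : 0 < a11)
    (hb00 : 0 < b00) (hb01 : 0 < b01) (hb10 : 0 < b10) (hb11 : 0 < b11)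
    (haminus : a00 * a11 = a01 * a10)
    (p m n : ℕ) (hp : 1 ≤ p) (hm : 1 ≤ m) (hn : 1 ≤ n)
    (ρ : ℝ) (hρ0 : 0 < ρ) (hρ : |b01 * b11 - b00 * b10| < ρ) :
    let ap : ℂ := ((a00 * a11 + a01 * a10 : ℝ) : ℂ)
    let bp : ℂ := ((b01 * b11 + b00 * b10 : ℝ) : ℂ)
    let bm : ℂ := ((b01 * b11 - b00 * b10 : ℝ) : ℂ)
    let cc : ℂ := (((a00 * b11 + a10 * b00) * (a11 * b01 + a01 * b10) +
        (a01 * b11 + a11 * b00) * (a10 * b01 + a00 * b10) : ℝ) : ℂ)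
    let dd : ℂ := ((a00 * b11 + a10 * b00 : ℝ) : ℂ)
    let A0 : ℂ → Matrix (Fin 2) (Fin 2) ℂ :=
      fun z => !![(b00 : ℂ), (a00 : ℂ); (a01 : ℂ) * z, (b01 : ℂ)]
    let A1 : ℂ → Matrix (Fin 2) (Fin 2) ℂ :=
      fun z => !![(b10 : ℂ), (a10 : ℂ); (a11 : ℂ) * z, (b11 : ℂ)]
    let A : ℂ → Matrix (Fin 2) (Fin 2) ℂ := fun z => A0 z * A1 z
    let φ : ℂ → ℂ := fun ζ => (ζ ^ 2 - bm ^ 2) / (2 * cc)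
    let φd : ℂ → ℂ := fun ζ => ζ / cc
    let lamh : ℂ → ℂ := fun ζ => (ap * φ ζ + bp + ζ) / 2
    let u : ℂ → Fin 2 → ℂ := fun ζ => ![1, (ζ + bm) / (2 * dd)]
    let v : ℂ → Fin 2 → ℂ := fun ζ => ![(ζ - bm) / (2 * ζ), dd / ζ]
    let Wm : ℂ → Matrix (Fin 2) (Fin 2) ℂ := fun z => z ^ (-((m + n : ℕ) : ℤ)) • A z ^ p
    let Ws : ℂ → ℂ := fun ω => lamh ω ^ p * φ ω ^ (-((m + n : ℕ) : ℤ)) / cc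
    ∀ K : ℂ → ℂ → Matrix (Fin 2) (Fin 2) ℂ, IsLeftRKCircleM 2 n 1 Wm K →
    ∀ Ks : ℂ → ℂ → ℂ, IsLeftRKCircleS (2 * n) ρ Ws Ks →
      (∀ Ks' : ℂ → ℂ → ℂ, IsLeftRKCircleS (2 * n) ρ Ws Ks' → Ks' = Ks) →
    ∀ ε₁ ε₂ : ℕ, (ε₁ = 0 ∨ ε₁ = 1) → (ε₂ = 0 ∨ ε₂ = 1) →
    ∀ x₁ x₂ y₁ y₂ : ℤ,
      1 ≤ 2 * x₁ + (ε₁ : ℤ) → 2 * x₁ + (ε₁ : ℤ) ≤ 2 * (p : ℤ) - 1 →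
      1 ≤ 2 * x₂ - (ε₂ : ℤ) → 2 * x₂ - (ε₂ : ℤ) ≤ 2 * (p : ℤ) - 1 →
      -((if 2 * x₂ - (ε₂ : ℤ) < 2 * x₁ + (ε₁ : ℤ) then (1 : ℂ) else 0) /
            (2 * (Real.pi : ℂ) * Complex.I)) •
          circleIntegralM 1 (fun z =>
            z ^ (y₂ - y₁ - 1) • (A1 z ^ ε₂ * A z ^ (x₁ - x₂).toNat * A0 z ^ ε₁))
        + (1 / (2 * (Real.pi : ℂ) * Complex.I)) •
          circleIntegralM 1 (fun w => circleIntegralM 1 (fun z =>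
            (w ^ (y₂ - (m : ℤ) - (n : ℤ)) * z ^ (-y₁ - 1)) •
              (A1 w ^ ε₂ * A w ^ ((p : ℤ) - x₂).toNat * K w z *
                A z ^ x₁.toNat * A0 z ^ ε₁)))
      = -((if 2 * x₂ - (ε₂ : ℤ) < 2 * x₁ + (ε₁ : ℤ) then (1 : ℂ) else 0) /
            (2 * (Real.pi : ℂ) * Complex.I)) •
          circleIntegralM ρ (fun ζ =>
            (lamh ζ ^ (x₁ - x₂) * φ ζ ^ (y₂ - y₁ - 1) * φd ζ) •
              (A1 (φ ζ) ^ ε₂ * Matrix.vecMulVec (u ζ) (v ζ) * A0 (φ ζ) ^ ε₁))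
        + (1 / (2 * (Real.pi : ℂ) * Complex.I)) •
          circleIntegralM ρ (fun ω => circleIntegralM ρ (fun ζ =>
            ((Ks ω ζ / ω) * lamh ω ^ ((p : ℤ) - x₂) * φ ω ^ (y₂ - (m : ℤ) - (n : ℤ)) *
              lamh ζ ^ x₁ * φ ζ ^ (-y₁ - 1) * φd ω * φd ζ) •
              (A1 (φ ω) ^ ε₂ * Matrix.vecMulVec (u ω) (v ζ) * A0 (φ ζ) ^ ε₁))) := by
  intro ap bp bm cc dd A0 A1 A φ φd lamh u v Wm Ws K hK Ks hKs huniq ε₁ ε₂ hε₁ hε₂ x₁ x₂ y₁ y₂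
    hx₁ hx₁' hx₂ hx₂'
  have hb : ‖bm‖ < ρ := by
    rw [Complex.norm_real]
    exact hρ
  have hc : cc ≠ 0 := Complex.ofReal_ne_zero.mpr (by positivity)
  have hd : dd ≠ 0 := Complex.ofReal_ne_zero.mpr (by positivity)
  have hcd : cc = 2 * dd * ((a11 : ℂ) * b01 + a01 * b10) := by
    have h : (a00 * b11 + a10 * b00) * (a11 * b01 + a01 * b10) +
        (a01 * b11 + a11 * b00) * (a10 * b01 + a00 * b10) =
        2 * (a00 * b11 + a10 * b00) * (a11 * b01 + a01 * b10) := by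
      linear_combination (b00 * b10 - b01 * b11) * haminus
    simp only [cc, dd, h]
    push_cast
    ring
  have ham : (a00 : ℂ) * a11 = a01 * a10 := by exact_mod_cast haminus
  have hφ : ∀ ζ, φ ζ = (ζ ^ 2 - bm ^ 2) / (2 * cc) := fun _ => rfl
  have hA0 : IsMatPolyFun 2 A0 := by
    refine .of_entries fun i j => ?_
    fin_cases i <;> fin_cases j
    · exact ⟨Polynomial.C (b00 : ℂ), by simp [A0]⟩
    · exact ⟨Polynomial.C (a00 : ℂ), by simp [A0]⟩
    · exact ⟨Polynomial.C (a01 : ℂ) * Polynomial.X, by simp [A0]⟩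
    · exact ⟨Polynomial.C (b01 : ℂ), by simp [A0]⟩
  have hA1 : IsMatPolyFun 2 A1 := by
    refine .of_entries fun i j => ?_
    fin_cases i <;> fin_cases j
    · exact ⟨Polynomial.C (b10 : ℂ), by simp [A1]⟩
    · exact ⟨Polynomial.C (a10 : ℂ), by simp [A1]⟩
    · exact ⟨Polynomial.C (a11 : ℂ) * Polynomial.X, by simp [A1]⟩
    · exact ⟨Polynomial.C (b11 : ℂ), by simp [A1]⟩
  have hA : IsMatPolyFun 2 A := hA0.mul hA1
  have hlam : Continuous lamh := by
    simp only [lamh, φ]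
    fun_prop
  have hE : ContinuousOn (spectralProj bm dd) (Metric.sphere 0 ρ) :=
    continuousOn_spectralProj bm dd fun ζ => ne_zero_of_mem_sphere_zero hρ0
  have hE1 : ∀ ζ, ζ ≠ 0 → spectralProj bm dd ζ + spectralProj bm dd (-ζ) = 1 :=
    fun ζ hζ => spectralProj_add_neg hd hζ
  have hAu : ∀ ζ, (A (φ ζ)).mulVec (u ζ) = lamh ζ • u ζ := by
    intro ζ
    have hq : 2 * cc * φ ζ = ζ ^ 2 - bm ^ 2 := by
      rw [hφ]
      field_simp
    rw [hcd] at hq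
    simp only [lamh]
    generalize φ ζ = z at hq
    have hdv : dd * ((ζ + bm) / (2 * dd)) = (ζ + bm) / 2 := by field_simp
    ext i
    fin_cases i
    · simp [A, A0, A1, u, Matrix.mulVec, dotProduct, Fin.sum_univ_two]
      simp only [dd, ap, bp, bm] at hdv ⊢
      push_cast at hdv ⊢
      linear_combination hdv + z / 2 * ham
    · simp [A, A0, A1, u, Matrix.mulVec, dotProduct, Fin.sum_univ_two]
      refine mul_left_cancel₀ hd ?_
      generalize (ζ + bm) / (2 * dd) = t at hdv ⊢
      simp only [ap, bp, bm] at hdv hq ⊢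
      push_cast at hdv hq ⊢
      linear_combination hq / 4 + (a01 * a10 * z + b01 * b11 -
        ((a00 * a11 + a01 * a10) * z + (b01 * b11 + b00 * b10) + ζ) / 2) * hdv -
        z * (ζ + (b01 * b11 - b00 * b10)) / 4 * ham
  have hAE : ∀ ζ, ζ ≠ 0 → A (φ ζ) * spectralProj bm dd ζ = lamh ζ • spectralProj bm dd ζ := by
    intro ζ _
    change A (φ ζ) * Matrix.vecMulVec (u ζ) (v ζ) = lamh ζ • Matrix.vecMulVec (u ζ) (v ζ)
    rw [Matrix.mul_vecMulVec, hAu, Matrix.smul_vecMulVec]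
  have hKeq := huniq _ (isLeftRKCircleS_of_isLeftRKCircleM hb hc hd hφ hlam hAE hA hn p _ hK)
  congr 1
  · by_cases hχ : 2 * x₂ - (ε₂ : ℤ) < 2 * x₁ + (ε₁ : ℤ)
    · obtain ⟨k, hk⟩ := Int.eq_ofNat_of_zero_le (show 0 ≤ x₁ - x₂ by omega)
      rw [hk, Int.toNat_natCast]
      congr 1
      rw [← circleIntegralM_spectral hb hc hφ hlam hE hE1 hAE hA (hA1.pow ε₂) (hA0.pow ε₁)]
      rfl
    · simp [hχ]
  · obtain ⟨k, hk⟩ := Int.eq_ofNat_of_zero_le (show 0 ≤ (p : ℤ) - x₂ by omega)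
    obtain ⟨k', hk'⟩ := Int.eq_ofNat_of_zero_le (show 0 ≤ x₁ by omega)
    rw [hk, hk', Int.toNat_natCast, Int.toNat_natCast]
    congr 1
    rw [← circleIntegralM_spectral_spectral hb hc hφ hlam hE hE1 hAE hA (hA1.pow ε₂)
      (hA0.pow ε₁) hK.1 hK.2.1]
    refine circleIntegralM_congr hρ0.le fun ω hω => circleIntegralM_congr hρ0.le fun ζ _ => ?_
    have hω0 := ne_zero_of_mem_sphere_zero hρ0 hω
    have huv : spectralProj bm dd ω * K (φ ω) (φ ζ) * spectralProj bm dd ζ =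
        (Ks ω ζ / ω) • Matrix.vecMulVec (u ω) (v ζ) := by
      rw [← hKeq]
      change Matrix.vecMulVec (u ω) (v ω) * K (φ ω) (φ ζ) * Matrix.vecMulVec (u ζ) (v ζ) = _
      ext i j
      simp only [Matrix.mul_apply, Fin.sum_univ_two, Matrix.vecMulVec_apply, Matrix.smul_apply,
        smul_eq_mul]
      generalize K (φ ω) (φ ζ) = M
      simp only [u, v, Matrix.cons_val_zero, Matrix.cons_val_one]
      field_simp
      ring
    have hsplit : A1 (φ ω) ^ ε₂ * spectralProj bm dd ω * K (φ ω) (φ ζ) * spectralProj bm dd ζ *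
        A0 (φ ζ) ^ ε₁ = A1 (φ ω) ^ ε₂ *
          (spectralProj bm dd ω * K (φ ω) (φ ζ) * spectralProj bm dd ζ) * A0 (φ ζ) ^ ε₁ := by
      simp only [mul_assoc]
    rw [hsplit, huv, mul_smul_comm, smul_mul_assoc, smul_smul]
    congr 1
    simp only [φd, zpow_natCast]
    ring
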